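/- arXiv:1607.06737 — 6 statements merged into one kernel-verified Lean document; each statement's English description precedes it below -/
import Mathlib

section
/- Let μ be a Borel probability measure on ℝ and let f(z) = ∫_ℝ (t - z)⁻¹ dμ(t) be its Cauchy transform. Then for every z ∈ ℂ with Im z > 0, the limit of s · f(s·z) as the real parameter s tends to +∞ exists and equals -z⁻¹. -/
open MeasureTheory Filter

/-- Rescaling the Cauchy kernel: `s (t - s z)⁻¹ = (t / s - z)⁻¹`. -/
lemma mul_inv_sub_mul_eq_inv_div_sub {K : Type*} [Field K] {s : K} (hs : s ≠ 0) (t z : K) :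
    s * (t - s * z)⁻¹ = (t / s - z)⁻¹ := by
  have h : t - s * z = s * (t / s - z) := by field_simp
  rw [h, mul_inv, mul_inv_cancel_left₀ hs]

/-- The Cauchy kernel at a real point is bounded by the inverse of the imaginary part. -/
lemma norm_inv_ofReal_sub_le {z : ℂ} (hz : 0 < z.im) (x : ℝ) :
    ‖((x : ℂ) - z)⁻¹‖ ≤ z.im⁻¹ := by
  rw [norm_inv]
  refine inv_anti₀ hz ?_
  simpa [abs_of_pos hz] using Complex.abs_im_le_norm ((x : ℂ) - z)

/-- For a Borel probability measure `μ` on ℝ with Cauchy transform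
`f(z) = ∫ (t - z)⁻¹ dμ(t)`, one has `s·f(s·z) → -z⁻¹` as the real parameter
`s → +∞`, for every `z` in the upper half plane. -/
theorem cauchyTransform_asymptotics
    (μ : Measure ℝ) [IsProbabilityMeasure μ] (z : ℂ) (hz : 0 < z.im) :
    Tendsto (fun s : ℝ => (s : ℂ) * ∫ t : ℝ, ((t : ℂ) - (s : ℂ) * z)⁻¹ ∂μ)
      atTop (nhds (-z⁻¹)) := by
  have hz0 : z ≠ 0 := by
    rintro rfl
    simp at hz
  have key : Tendsto (fun s : ℝ => ∫ t : ℝ, (((t / s : ℝ) : ℂ) - z)⁻¹ ∂μ) atTop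
      (nhds (∫ _ : ℝ, -z⁻¹ ∂μ)) := by
    refine tendsto_integral_filter_of_dominated_convergence (fun _ => z.im⁻¹) ?_ ?_
      (integrable_const _) ?_
    · exact .of_forall fun s => Measurable.aestronglyMeasurable (by fun_prop)
    · exact .of_forall fun s => .of_forall fun t => norm_inv_ofReal_sub_le hz _
    · refine .of_forall fun t => ?_
      have h : Tendsto (fun s : ℝ => ((t / s : ℝ) : ℂ) - z) atTop (nhds (((0 : ℝ) : ℂ) - z)) :=
        ((Complex.continuous_ofReal.tendsto 0).comp (tendsto_id.const_div_atTop t)).sub_const z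
      simpa [inv_neg] using h.inv₀ (by simpa using hz0)
  rw [integral_const, probReal_univ, one_smul] at key
  refine key.congr' ?_
  filter_upwards [eventually_gt_atTop 0] with s hs
  have hs' : (s : ℂ) ≠ 0 := by exact_mod_cast hs.ne'
  simp_rw [← integral_const_mul, mul_inv_sub_mul_eq_inv_div_sub hs', Complex.ofReal_div]
end

section
/- (Nevanlinna's theorem, converse direction.) Let f : ℂ → ℂ be holomorphic on the upper half plane Π = {z ∈ ℂ : Im z > 0} and satisfy Im f(z) ≥ 0 for all z ∈ Π. Suppose that for every z ∈ Π, s · f(s·z) tends to -z⁻¹ as the real parameter s tends to +∞. Then there exists a Borel probability measure μ on ℝ such that f(z) = ∫_ℝ (t - z)⁻¹ dμ(t) for all z ∈ Π. -/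
open MeasureTheory Filter

open scoped Topology

theorem continuous_poissonKernel_circleMap {w : ℂ} (hw : w ∈ Metric.ball (0 : ℂ) 1) :
    Continuous fun θ : ℝ => poissonKernel 0 w (circleMap 0 1 θ) := by
  have hw' : ‖w‖ < 1 := by simpa using hw
  simp only [poissonKernel_def]
  refine Continuous.div (by fun_prop) (by fun_prop) fun θ h => ?_
  have h1 : circleMap 0 1 θ = w := by simpa [sub_eq_zero] using h
  have h2 : ‖circleMap 0 1 θ‖ = 1 := by simp
  rw [h1] at h2
  linarith

/-- The Poisson integral formula on the unit disc for the imaginary part, with the Poisson integral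
written against a finite measure on `[0, 2π]`. -/
theorem exists_finiteMeasure_im_eq_integral_poissonKernel {G : ℂ → ℂ}
    (hG : DiffContOnCl ℂ G (Metric.ball 0 1))
    (him : ∀ w ∈ Metric.closedBall (0 : ℂ) 1, 0 ≤ (G w).im) :
    ∃ σ : FiniteMeasure ℝ, σ (Set.Icc 0 (2 * Real.pi))ᶜ = 0 ∧ ∀ w ∈ Metric.ball (0 : ℂ) 1,
      (G w).im = ∫ θ, poissonKernel 0 w (circleMap 0 1 θ) ∂(σ : Measure ℝ) := by
  have hmem (θ : ℝ) : circleMap 0 1 θ ∈ Metric.closedBall (0 : ℂ) 1 :=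
    circleMap_mem_closedBall 0 zero_le_one θ
  have hcont : Continuous fun θ : ℝ => G (circleMap 0 1 θ) := by
    have h := hG.continuousOn
    rw [closure_ball _ one_ne_zero] at h
    exact h.comp_continuous (continuous_circleMap 0 1) hmem
  set d : ℝ → ℝ := fun θ => (2 * Real.pi)⁻¹ * (G (circleMap 0 1 θ)).im with hd
  have hdc : Continuous d := continuous_const.mul (Complex.continuous_im.comp hcont)
  have hd0 (θ : ℝ) : 0 ≤ d θ := mul_nonneg (by positivity) (him _ (hmem θ))
  set ν : Measure ℝ := (volume.restrict (Set.Ioc 0 (2 * Real.pi))).withDensity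
    fun θ => ENNReal.ofReal (d θ) with hν
  have hint : Integrable d (volume.restrict (Set.Ioc 0 (2 * Real.pi))) :=
    (hdc.integrableOn_Icc (a := 0) (b := 2 * Real.pi)).mono_set Set.Ioc_subset_Icc_self
  have : IsFiniteMeasure ν := isFiniteMeasure_withDensity_ofReal hint.2
  refine ⟨⟨ν, inferInstance⟩, ?_, fun w hw => ?_⟩
  · have hac : ν ≪ volume.restrict (Set.Ioc 0 (2 * Real.pi)) := withDensity_absolutelyContinuous _ _
    have h0 : ν (Set.Icc 0 (2 * Real.pi))ᶜ = 0 := by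
      apply hac
      rw [Measure.restrict_apply measurableSet_Icc.compl]
      convert measure_empty (μ := (volume : Measure ℝ))
      ext x
      simp only [Set.mem_inter_iff, Set.mem_compl_iff, Set.mem_Icc, Set.mem_Ioc,
        Set.mem_empty_iff_false, iff_false]
      rintro ⟨h1, h2, h3⟩
      exact h1 ⟨h2.le, h3⟩
    simp [FiniteMeasure.mk_apply, h0]
  · have hP := continuous_poissonKernel_circleMap hw
    have h := hG.circleAverage_poissonKernel_smul hw
    rw [Real.circleAverage_def] at h
    rw [← h]
    change _ = ∫ θ, _ ∂ν
    rw [hν, integral_withDensity_eq_integral_toReal_smul (by fun_prop) (by simp),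
      intervalIntegral.integral_of_le (by positivity), Complex.smul_im]
    have hI : Integrable (fun θ : ℝ => (poissonKernel 0 w • G) (circleMap 0 1 θ))
        (volume.restrict (Set.Ioc 0 (2 * Real.pi))) :=
      ((hP.smul hcont).integrableOn_Icc (a := 0) (b := 2 * Real.pi)).mono_set
        Set.Ioc_subset_Icc_self
    have h' := integral_im hI
    simp only [RCLike.im_to_complex] at h'
    rw [← h', smul_eq_mul, ← integral_const_mul]
    refine integral_congr_ae (Eventually.of_forall fun θ => ?_)
    simp only [ENNReal.toReal_ofReal (hd0 θ)]
    simp [hd]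
    ring

/-- The Poisson kernel of the unit disc is bounded on the unit circle and continuous there. -/
theorem exists_boundedContinuousFunction_poissonKernel {w : ℂ} (hw : w ∈ Metric.ball (0 : ℂ) 1) :
    ∃ g : BoundedContinuousFunction ℝ ℝ, ∀ θ, g θ = poissonKernel 0 w (circleMap 0 1 θ) := by
  have hw' : ‖w‖ < 1 := by simpa using hw
  have hP := continuous_poissonKernel_circleMap hw
  refine ⟨BoundedContinuousFunction.ofNormedAddCommGroup _ hP ((1 + ‖w‖) / (1 - ‖w‖)) fun θ => ?_,
    fun θ => rfl⟩
  have hs : circleMap 0 1 θ ∈ Metric.sphere (0 : ℂ) 1 := circleMap_mem_sphere 0 zero_le_one θ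
  have hub := re_herglotzRieszKernel_le hs hw
  have hlb := le_re_herglotzRieszKernel hs hw
  have he : poissonKernel 0 w (circleMap 0 1 θ) = _ :=
    congrFun (poissonKernel_eq_re_herglotzRieszKernel (c := 0) (w := w)) (circleMap 0 1 θ)
  rw [Function.comp_apply, herglotzRieszKernel_def] at he
  rw [sub_zero w] at hub hlb
  rw [sub_zero w] at he
  rw [he, Real.norm_eq_abs, abs_le]
  refine ⟨?_, hub⟩
  have : 0 ≤ (1 - ‖w‖) / (1 + ‖w‖) := div_nonneg (by linarith) (by positivity)
  have : 0 ≤ (1 + ‖w‖) / (1 - ‖w‖) := div_nonneg (by positivity) (by linarith)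
  linarith

/-- **Herglotz representation** of the imaginary part of a function holomorphic on the unit disc
with values in the closed upper half plane. -/
theorem exists_measure_im_eq_integral_poissonKernel {G : ℂ → ℂ}
    (hG : DifferentiableOn ℂ G (Metric.ball 0 1))
    (him : ∀ w ∈ Metric.ball (0 : ℂ) 1, 0 ≤ (G w).im) :
    ∃ σ : Measure ℝ, IsFiniteMeasure σ ∧ ∀ w ∈ Metric.ball (0 : ℂ) 1,
      Integrable (fun θ => poissonKernel 0 w (circleMap 0 1 θ)) σ ∧
      (G w).im = ∫ θ, poissonKernel 0 w (circleMap 0 1 θ) ∂σ := by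
  obtain ⟨r, -, hr, hlim⟩ := exists_seq_strictMono_tendsto' (show (0 : ℝ) < 1 by norm_num)
  have hmaps (n : ℕ) : ∀ w ∈ Metric.closedBall (0 : ℂ) 1,
      (r n : ℂ) * w ∈ Metric.ball (0 : ℂ) 1 := by
    intro w hw
    rw [mem_closedBall_zero_iff] at hw
    rw [mem_ball_zero_iff, norm_mul, Complex.norm_real, Real.norm_eq_abs, abs_of_pos (hr n).1]
    nlinarith [(hr n).1, (hr n).2]
  have hdil (n : ℕ) : DiffContOnCl ℂ (fun w => G (r n * w)) (Metric.ball 0 1) := by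
    apply DifferentiableOn.diffContOnCl
    rw [closure_ball _ one_ne_zero]
    exact hG.comp (by fun_prop) (hmaps n)
  choose σ hσ0 hσ using fun n => exists_finiteMeasure_im_eq_integral_poissonKernel (hdil n)
    fun w hw => him _ (hmaps n w hw)
  have hmass (n : ℕ) : (σ n).mass ≤ (G 0).im.toNNReal := by
    have h := hσ n 0 (by simp)
    have h1 (θ : ℝ) : poissonKernel 0 0 (circleMap 0 1 θ) = 1 := by simp [poissonKernel_def]
    simp only [mul_zero, h1, integral_const, smul_eq_mul, mul_one] at h
    rw [h, Measure.real, ← FiniteMeasure.ennreal_mass, ENNReal.coe_toReal, Real.toNNReal_coe]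
  obtain ⟨ν, -, hν⟩ := (isCompact_setOfPred_finiteMeasure_le_of_isCompact (E := ℝ) (G 0).im.toNNReal
    (isCompact_Icc (a := 0) (b := 2 * Real.pi))).ultrafilter_le_nhds
    ((hyperfilter ℕ).map σ) (by
      rw [le_principal_iff]
      exact (Ultrafilter.mem_map (f := hyperfilter ℕ)).2
        (Eventually.of_forall fun n => ⟨hmass n, hσ0 n⟩))
  refine ⟨ν, inferInstance, fun w hw => ?_⟩
  obtain ⟨g, hg⟩ := exists_boundedContinuousFunction_poissonKernel hw
  simp only [← hg]
  refine ⟨g.integrable _, ?_⟩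
  have ht : Tendsto σ (hyperfilter ℕ) (𝓝 ν) := hν
  have h1 := FiniteMeasure.tendsto_iff_forall_integral_tendsto.1 ht g
  have h2 : Tendsto (fun n => (G (r n * w)).im) (hyperfilter ℕ) (𝓝 (G w).im) := by
    have hc : ContinuousAt G w :=
      (hG.differentiableAt (Metric.isOpen_ball.mem_nhds hw)).continuousAt
    have hl : Tendsto (fun n => (r n : ℂ) * w) atTop (𝓝 w) := by
      simpa using ((Complex.continuous_ofReal.tendsto _).comp hlim).mul_const w
    exact ((Complex.continuous_im.tendsto _).comp (hc.tendsto.comp hl)).mono_left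
      Nat.hyperfilter_le_atTop
  refine tendsto_nhds_unique h2 (h1.congr fun n => ?_)
  rw [hσ n w hw]
  simp only [hg]

/-- The Poisson kernel of the unit disc in half plane coordinates. -/
theorem poissonKernel_cayley {z : ℂ} (hz : 0 < z.im) (θ : ℝ) :
    poissonKernel 0 ((z - Complex.I) / (z + Complex.I)) (circleMap 0 1 θ) =
      z.im / Complex.normSq (Real.cos (θ / 2) + z * Real.sin (θ / 2)) := by
  set c := Real.cos (θ / 2)
  set s := Real.sin (θ / 2)
  have hcs : s ^ 2 + c ^ 2 = 1 := Real.sin_sq_add_cos_sq _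
  have hcs' : (s : ℂ) ^ 2 + (c : ℂ) ^ 2 = 1 := by exact_mod_cast hcs
  have hI := Complex.I_sq
  have hζ : circleMap 0 1 θ = (c + s * Complex.I) ^ 2 := by
    have h : circleMap 0 1 θ = Complex.exp ((θ / 2 : ℝ) * Complex.I) ^ 2 := by
      rw [← Complex.exp_nat_mul]
      simp [circleMap]
      ring_nf
    rw [h, Complex.exp_mul_I, Complex.ofReal_cos, Complex.ofReal_sin]
  have hne : z + Complex.I ≠ 0 := by
    intro h
    have := congrArg Complex.im h
    simp at this
    linarith
  have hnum : (1 : ℝ) - ‖(z - Complex.I) / (z + Complex.I)‖ ^ 2 =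
      4 * z.im / Complex.normSq (z + Complex.I) := by
    have h0 : Complex.normSq (z + Complex.I) ≠ 0 := by simpa using hne
    rw [← Complex.normSq_eq_norm_sq, Complex.normSq_div]
    field_simp
    simp [Complex.normSq_apply]
    ring
  have hden : circleMap 0 1 θ - (z - Complex.I) / (z + Complex.I) =
      2 * Complex.I * (c + s * Complex.I) * (c + z * s) / (z + Complex.I) := by
    rw [hζ]
    field_simp
    linear_combination (z - Complex.I) * hcs' +
      s ^ 2 * (Complex.I - z) * hI
  have he : Complex.normSq (c + s * Complex.I) = 1 := by
    simp [Complex.normSq_apply]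
    linarith
  rw [poissonKernel_def, sub_zero, sub_zero, norm_circleMap_zero, abs_one, one_pow, hnum, hden,
    ← Complex.normSq_eq_norm_sq, Complex.normSq_div, Complex.normSq_mul, Complex.normSq_mul,
    Complex.normSq_mul, he]
  have h0 : Complex.normSq (z + Complex.I) ≠ 0 := by simpa using hne
  rw [div_div_div_cancel_right₀ h0]
  simp
  norm_num
  rw [mul_div_mul_left _ _ (by norm_num : (4 : ℝ) ≠ 0)]

/-- Herglotz representation on the upper half plane, with the boundary parametrized by
`θ ↦ -cot (θ / 2)`. -/
theorem exists_measure_im_eq_integral_halfAngle {f : ℂ → ℂ}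
    (hdiff : ∀ z : ℂ, 0 < z.im → DifferentiableAt ℂ f z)
    (hmap : ∀ z : ℂ, 0 < z.im → 0 ≤ (f z).im) :
    ∃ σ : Measure ℝ, IsFiniteMeasure σ ∧ ∀ z : ℂ, 0 < z.im →
      Integrable (fun θ : ℝ =>
        z.im / Complex.normSq (Real.cos (θ / 2) + z * Real.sin (θ / 2))) σ ∧
      (f z).im = ∫ θ : ℝ,
        z.im / Complex.normSq (Real.cos (θ / 2) + z * Real.sin (θ / 2)) ∂σ := by
  have hne {w : ℂ} (hw : w ∈ Metric.ball (0 : ℂ) 1) : 1 - w ≠ 0 := by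
    intro h
    rw [sub_eq_zero] at h
    simp [← h] at hw
  have him {w : ℂ} (hw : w ∈ Metric.ball (0 : ℂ) 1) :
      0 < (Complex.I * (1 + w) / (1 - w)).im := by
    have h0 : 0 < Complex.normSq (1 - w) := Complex.normSq_pos.2 (hne hw)
    have h1 : Complex.normSq w < 1 := by
      rw [Complex.normSq_eq_norm_sq]
      have : ‖w‖ < 1 := by simpa using hw
      nlinarith [norm_nonneg w]
    have h2 : (Complex.I * (1 + w) / (1 - w)).im =
        (1 - Complex.normSq w) / Complex.normSq (1 - w) := by
      rw [Complex.div_im, ← sub_div]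
      congr 1
      simp [Complex.normSq_apply]
      ring
    rw [h2]
    exact div_pos (by linarith) h0
  obtain ⟨σ, hσ, h⟩ := exists_measure_im_eq_integral_poissonKernel
    (G := fun w => f (Complex.I * (1 + w) / (1 - w)))
    (fun w hw => by
      have hφ : DifferentiableAt ℂ (fun w : ℂ => Complex.I * (1 + w) / (1 - w)) w :=
        DifferentiableAt.div (by fun_prop) (by fun_prop) (hne hw)
      exact (DifferentiableAt.comp w (hdiff _ (him hw)) hφ).differentiableWithinAt)
    fun w hw => hmap _ (him hw)
  refine ⟨σ, hσ, fun z hz => ?_⟩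
  have hzI : z + Complex.I ≠ 0 := by
    intro h
    have := congrArg Complex.im h
    simp at this
    linarith
  have hw : (z - Complex.I) / (z + Complex.I) ∈ Metric.ball (0 : ℂ) 1 := by
    rw [mem_ball_zero_iff, norm_div, div_lt_one (norm_pos_iff.2 hzI)]
    refine lt_of_pow_lt_pow_left₀ 2 (norm_nonneg _) ?_
    rw [← Complex.normSq_eq_norm_sq, ← Complex.normSq_eq_norm_sq]
    simp only [Complex.normSq_apply, Complex.sub_re, Complex.sub_im, Complex.add_re,
      Complex.add_im, Complex.I_re, Complex.I_im]
    nlinarith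
  have hzw : Complex.I * (1 + (z - Complex.I) / (z + Complex.I)) /
      (1 - (z - Complex.I) / (z + Complex.I)) = z := by
    have h1 : 1 + (z - Complex.I) / (z + Complex.I) = 2 * z / (z + Complex.I) := by
      field_simp
      ring
    have h2 : 1 - (z - Complex.I) / (z + Complex.I) = 2 * Complex.I / (z + Complex.I) := by
      field_simp
      ring
    rw [h1, h2]
    have := Complex.I_ne_zero
    field_simp
  simpa only [poissonKernel_cayley hz, hzw] using h _ hw

/-- If the kernels `y² / (cos² + y² sin²)` have integrals tending to `1` as `y → ∞`, then
the inverse squared half-angle sine has total integral `1`. -/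
theorem lintegral_inv_sin_sq_eq_one {σ : Measure ℝ}
    (hint : ∀ y : ℝ, 0 < y → Integrable
      (fun θ : ℝ => y ^ 2 / (Real.cos (θ / 2) ^ 2 + y ^ 2 * Real.sin (θ / 2) ^ 2)) σ)
    (hlim : Tendsto (fun y : ℝ =>
      ∫ θ : ℝ, y ^ 2 / (Real.cos (θ / 2) ^ 2 + y ^ 2 * Real.sin (θ / 2) ^ 2) ∂σ) atTop (𝓝 1)) :
    ∫⁻ θ : ℝ, (ENNReal.ofReal (Real.sin (θ / 2) ^ 2))⁻¹ ∂σ = 1 := by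
  set k : ℝ → ℝ → ℝ := fun y θ =>
    y ^ 2 / (Real.cos (θ / 2) ^ 2 + y ^ 2 * Real.sin (θ / 2) ^ 2) with hk
  have hk0 (y θ : ℝ) : 0 ≤ k y θ := by positivity
  have hkinv (y : ℝ) (hy : 0 < y) (θ : ℝ) : ENNReal.ofReal (k y θ) =
      (ENNReal.ofReal (Real.cos (θ / 2) ^ 2 * (y ^ 2)⁻¹ + Real.sin (θ / 2) ^ 2))⁻¹ := by
    have hcs := Real.sin_sq_add_cos_sq (θ / 2)
    have hpos : 0 < Real.cos (θ / 2) ^ 2 * (y ^ 2)⁻¹ + Real.sin (θ / 2) ^ 2 := by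
      rcases eq_or_ne (Real.sin (θ / 2)) 0 with h | h
      · have : Real.cos (θ / 2) ^ 2 = 1 := by simpa [h] using hcs
        rw [this]
        positivity
      · positivity
    rw [← ENNReal.ofReal_inv_of_pos hpos]
    congr 1
    simp only [hk]
    rw [← inv_div]
    congr 1
    field_simp
  have hlim' : Tendsto (fun y : ℝ => ∫⁻ θ, ENNReal.ofReal (k y θ) ∂σ) atTop (𝓝 1) := by
    have h := (ENNReal.continuous_ofReal.tendsto 1).comp hlim
    rw [ENNReal.ofReal_one] at h
    refine h.congr' ?_
    filter_upwards [eventually_gt_atTop 0] with y hy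
    exact ofReal_integral_eq_lintegral_ofReal (hint y hy) (Eventually.of_forall (hk0 y))
  apply le_antisymm
  · have hpt (θ : ℝ) : Tendsto (fun y : ℝ => ENNReal.ofReal (k y θ)) atTop
        (𝓝 (ENNReal.ofReal (Real.sin (θ / 2) ^ 2))⁻¹) := by
      have h1 : Tendsto (fun y : ℝ => Real.cos (θ / 2) ^ 2 * (y ^ 2)⁻¹ + Real.sin (θ / 2) ^ 2)
          atTop (𝓝 (Real.sin (θ / 2) ^ 2)) := by
        have h2 : Tendsto (fun y : ℝ => (y ^ 2)⁻¹) atTop (𝓝 0) :=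
          tendsto_inv_atTop_zero.comp (tendsto_pow_atTop two_ne_zero)
        simpa using (h2.const_mul (Real.cos (θ / 2) ^ 2)).add_const (Real.sin (θ / 2) ^ 2)
      refine (((ENNReal.continuous_ofReal.tendsto _).comp h1).inv).congr' ?_
      filter_upwards [eventually_gt_atTop 0] with y hy
      exact (hkinv y hy θ).symm
    calc ∫⁻ θ : ℝ, (ENNReal.ofReal (Real.sin (θ / 2) ^ 2))⁻¹ ∂σ
        = ∫⁻ θ, liminf (fun y : ℝ => ENNReal.ofReal (k y θ)) atTop ∂σ :=
          lintegral_congr fun θ => (hpt θ).liminf_eq.symm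
      _ ≤ liminf (fun y : ℝ => ∫⁻ θ, ENNReal.ofReal (k y θ) ∂σ) atTop :=
          lintegral_liminf_le fun y => by simp only [hk]; fun_prop
      _ = 1 := hlim'.liminf_eq
  · refine le_of_tendsto hlim' ?_
    filter_upwards [eventually_gt_atTop 0] with y hy
    refine lintegral_mono fun θ => ?_
    simp only [hkinv y hy θ]
    gcongr
    have : 0 ≤ Real.cos (θ / 2) ^ 2 * (y ^ 2)⁻¹ := by positivity
    linarith

theorem integrable_inv_ofReal_sub {μ : Measure ℝ} [IsFiniteMeasure μ] {z : ℂ} (hz : 0 < z.im) :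
    Integrable (fun t : ℝ => ((t : ℂ) - z)⁻¹) μ := by
  have h := integrable_resolvent (𝕜 := ℝ) (A := ℂ) (μ := μ) (a := z) (by
    rintro ⟨x, -, rfl⟩
    simp at hz)
  exact h.congr (Eventually.of_forall fun t => by simp [resolvent])

theorem differentiableAt_integral_inv_ofReal_sub {μ : Measure ℝ} [IsFiniteMeasure μ] {z : ℂ}
    (hz : 0 < z.im) : DifferentiableAt ℂ (fun z => ∫ t : ℝ, ((t : ℂ) - z)⁻¹ ∂μ) z := by
  have h := (hasDerivAt_resolventTransform (𝕜 := ℝ) (A := ℂ) (μ := μ) z (by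
    rintro ⟨x, -, rfl⟩
    simp at hz)).differentiableAt
  simpa [resolventTransform_def, resolvent] using h

theorem norm_integral_inv_ofReal_sub_le {μ : Measure ℝ} [IsProbabilityMeasure μ] {z : ℂ}
    (hz : 0 < z.im) : ‖∫ t : ℝ, ((t : ℂ) - z)⁻¹ ∂μ‖ ≤ z.im⁻¹ := by
  refine (norm_integral_le_of_norm_le_const (C := z.im⁻¹)
    (Eventually.of_forall fun t => ?_)).trans (by simp)
  rw [norm_inv]
  gcongr
  have h := Complex.abs_im_le_norm ((t : ℂ) - z)
  simpa [abs_of_pos hz] using h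

/-- The imaginary part of a function satisfying the hypotheses of Nevanlinna's theorem is the
Poisson integral of a probability measure on the real line. -/
theorem exists_isProbabilityMeasure_im_eq {f : ℂ → ℂ}
    (hdiff : ∀ z : ℂ, 0 < z.im → DifferentiableAt ℂ f z)
    (hmap : ∀ z : ℂ, 0 < z.im → 0 ≤ (f z).im)
    (hlim : Tendsto (fun y : ℝ => y * (f (y * Complex.I)).im) atTop (𝓝 1)) :
    ∃ μ : Measure ℝ, IsProbabilityMeasure μ ∧
      ∀ z : ℂ, 0 < z.im → (f z).im = (∫ t : ℝ, ((t : ℂ) - z)⁻¹ ∂μ).im := by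
  obtain ⟨σ, hσ, h⟩ := exists_measure_im_eq_integral_halfAngle hdiff hmap
  have hker (y θ : ℝ) : y ^ 2 / (Real.cos (θ / 2) ^ 2 + y ^ 2 * Real.sin (θ / 2) ^ 2) =
      y * ((y * Complex.I).im /
        Complex.normSq (Real.cos (θ / 2) + y * Complex.I * Real.sin (θ / 2))) := by
    have h1 : Complex.normSq (Real.cos (θ / 2) + y * Complex.I * Real.sin (θ / 2)) =
        Real.cos (θ / 2) ^ 2 + y ^ 2 * Real.sin (θ / 2) ^ 2 := by
      simp only [Complex.normSq_apply, Complex.add_re, Complex.add_im, Complex.mul_re,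
        Complex.mul_im, Complex.ofReal_re, Complex.ofReal_im, Complex.I_re, Complex.I_im]
      ring
    rw [h1, ← mul_div_assoc]
    congr 1
    simp [sq]
  have hone : ∫⁻ θ : ℝ, (ENNReal.ofReal (Real.sin (θ / 2) ^ 2))⁻¹ ∂σ = 1 := by
    apply lintegral_inv_sin_sq_eq_one
    · intro y hy
      simp only [hker]
      exact (h (y * Complex.I) (by simpa using hy)).1.const_mul y
    · refine hlim.congr' ?_
      filter_upwards [eventually_gt_atTop 0] with y hy
      simp only [hker]
      rw [integral_const_mul, (h (y * Complex.I) (by simpa using hy)).2]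
  have hdm : Measurable fun θ : ℝ => (ENNReal.ofReal (Real.sin (θ / 2) ^ 2))⁻¹ := by fun_prop
  have hfin : ∀ᵐ θ ∂σ, (ENNReal.ofReal (Real.sin (θ / 2) ^ 2))⁻¹ < ⊤ :=
    ae_lt_top hdm (by simp [hone])
  set ρ := σ.withDensity fun θ : ℝ => (ENNReal.ofReal (Real.sin (θ / 2) ^ 2))⁻¹ with hρ
  have hρ1 : IsProbabilityMeasure ρ := ⟨by
    rw [hρ, withDensity_apply _ MeasurableSet.univ, Measure.restrict_univ, hone]⟩
  have hτ : Measurable fun θ : ℝ => -(Real.cos (θ / 2) / Real.sin (θ / 2)) := by fun_prop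
  have hμ : IsProbabilityMeasure (ρ.map fun θ : ℝ => -(Real.cos (θ / 2) / Real.sin (θ / 2))) :=
    Measure.isProbabilityMeasure_map hτ.aemeasurable
  refine ⟨_, hμ, fun z hz => ?_⟩
  have him := integral_im (integrable_inv_ofReal_sub
    (μ := ρ.map fun θ : ℝ => -(Real.cos (θ / 2) / Real.sin (θ / 2))) hz)
  simp only [RCLike.im_to_complex] at him
  rw [← him, (h z hz).2, integral_map hτ.aemeasurable (by fun_prop), hρ,
    integral_withDensity_eq_integral_toReal_smul hdm hfin]
  refine integral_congr_ae ?_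
  filter_upwards [hfin] with θ hθ
  have hs : Real.sin (θ / 2) ≠ 0 := by
    intro h0
    simp [h0] at hθ
  have hs2 : 0 ≤ Real.sin (θ / 2) ^ 2 := by positivity
  have hN : ((-(Real.cos (θ / 2) / Real.sin (θ / 2)) : ℝ) : ℂ) - z =
      -((Real.cos (θ / 2) + z * Real.sin (θ / 2)) / Real.sin (θ / 2)) := by
    have : (Real.sin (θ / 2) : ℂ) ≠ 0 := by exact_mod_cast hs
    push_cast at this ⊢
    field_simp
    ring
  have him' : (((-(Real.cos (θ / 2) / Real.sin (θ / 2)) : ℝ) : ℂ) - z).im = -z.im := by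
    rw [Complex.sub_im, Complex.ofReal_im, zero_sub]
  rw [Complex.inv_im, him', hN, Complex.normSq_neg, Complex.normSq_div, Complex.normSq_ofReal,
    ENNReal.toReal_inv, ENNReal.toReal_ofReal hs2, neg_neg, smul_eq_mul]
  field_simp

/-- Nevanlinna's theorem (converse direction): a function holomorphic on the upper
half plane, mapping it into the closed upper half plane, and satisfying the
asymptotic condition `s·f(s·z) → -z⁻¹` as real `s → +∞` for every `z` in the upper
half plane, is the Cauchy transform of a Borel probability measure on ℝ. -/
theorem nevanlinna_converse
    (f : ℂ → ℂ)
    (hdiff : ∀ z : ℂ, 0 < z.im → DifferentiableAt ℂ f z)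
    (hmap : ∀ z : ℂ, 0 < z.im → 0 ≤ (f z).im)
    (hasym : ∀ z : ℂ, 0 < z.im →
      Tendsto (fun s : ℝ => (s : ℂ) * f ((s : ℂ) * z)) atTop (nhds (-z⁻¹))) :
    ∃ μ : Measure ℝ, IsProbabilityMeasure μ ∧
      ∀ z : ℂ, 0 < z.im → f z = ∫ t : ℝ, ((t : ℂ) - z)⁻¹ ∂μ := by
  have hI : Tendsto (fun s : ℝ => (s : ℂ) * f (s * Complex.I)) atTop (𝓝 Complex.I) := by
    simpa using hasym Complex.I (by simp)
  obtain ⟨μ, hμ, him⟩ := exists_isProbabilityMeasure_im_eq hdiff hmap (by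
    simpa [Function.comp_def] using (Complex.continuous_im.tendsto _).comp hI)
  refine ⟨μ, hμ, ?_⟩
  have hopen : IsOpen {z : ℂ | 0 < z.im} := isOpen_lt continuous_const Complex.continuous_im
  have hconn : IsConnected {z : ℂ | 0 < z.im} :=
    (convex_halfSpace_im_gt 0).isConnected ⟨Complex.I, by simp⟩
  have han : AnalyticOnNhd ℂ (fun z => f z - ∫ t : ℝ, ((t : ℂ) - z)⁻¹ ∂μ) {z : ℂ | 0 < z.im} :=
    DifferentiableOn.analyticOnNhd (fun z hz => ((hdiff z hz).sub
      (differentiableAt_integral_inv_ofReal_sub hz)).differentiableWithinAt) hopen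
  obtain ⟨c, hc⟩ := han.eq_const_of_im_eq_const (c₀ := 0)
    (fun z hz => by rw [Complex.sub_im, him z hz, sub_self]) hopen hconn
  have hinv : Tendsto (fun s : ℝ => s⁻¹) atTop (𝓝 0) := tendsto_inv_atTop_zero
  have hf0 : Tendsto (fun s : ℝ => f (s * Complex.I)) atTop (𝓝 0) := by
    have h := ((Complex.continuous_ofReal.tendsto _).comp hinv).mul hI
    rw [Complex.ofReal_zero, zero_mul] at h
    refine h.congr' ?_
    filter_upwards [eventually_gt_atTop 0] with s hs
    have : (s : ℂ) ≠ 0 := by exact_mod_cast hs.ne'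
    simp [this]
  have hC0 : Tendsto (fun s : ℝ => ∫ t : ℝ, ((t : ℂ) - s * Complex.I)⁻¹ ∂μ) atTop (𝓝 0) := by
    refine squeeze_zero_norm' ?_ hinv
    filter_upwards [eventually_gt_atTop 0] with s hs
    simpa using norm_integral_inv_ofReal_sub_le (μ := μ) (z := s * Complex.I) (by simpa using hs)
  have hc0 : c = 0 := by
    have h := hf0.sub hC0
    rw [sub_zero] at h
    refine tendsto_nhds_unique (tendsto_const_nhds.congr' ?_) h
    filter_upwards [eventually_gt_atTop 0] with s hs
    exact (hc (s * Complex.I) (by simpa using hs)).symm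
  intro z hz
  exact sub_eq_zero.1 ((hc z hz).trans hc0)
end

section
/- (Herglotz representation theorem.) Let h : ℂ → ℂ be holomorphic on the open unit disk 𝔻 = {λ ∈ ℂ : |λ| < 1} and satisfy Re h(λ) ≥ 0 for all λ ∈ 𝔻. Then there exist a real number b and a finite Borel measure μ on the unit circle {ω ∈ ℂ : |ω| = 1} such that for all λ with |λ| < 1, h(λ) = i·b + ∫ (ω + λ)/(ω - λ) dμ(ω). -/
open MeasureTheory

open Metric Real Filter Topology ComplexConjugate

/-- **Schwarz integral formula** on the unit disk. -/
theorem schwarz_integral_formula {g : ℂ → ℂ} (hg : DiffContOnCl ℂ g (ball 0 1)) {w : ℂ}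
    (hw : w ∈ ball (0 : ℂ) 1) :
    circleAverage (fun z ↦ (z + w) / (z - w) * ((g z).re : ℂ)) 0 1 =
      g w - Complex.I * ((g 0).im : ℂ) := by
  have hw1 : ‖w‖ < 1 := by simpa using hw
  have hgc : ContinuousOn g (sphere 0 1) :=
    hg.2.mono (sphere_subset_closedBall.trans_eq (closure_ball 0 one_ne_zero).symm)
  have hzw : ∀ z ∈ sphere (0 : ℂ) 1, z - w ≠ 0 := fun z hz h0 ↦ by
    have : ‖z‖ = 1 := by simpa using hz
    rw [sub_eq_zero.1 h0] at this
    exact hw1.ne this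
  have hK : ContinuousOn (fun z : ℂ ↦ (z + w) / (z - w)) (sphere 0 1) :=
    ContinuousOn.div (by fun_prop) (by fun_prop) hzw
  have hden : ∀ z ∈ closedBall (0 : ℂ) 1, 1 - z * conj w ≠ 0 := fun z hz h0 ↦ by
    have hz1 : ‖z‖ ≤ 1 := by simpa using hz
    have h1 : ‖z * conj w‖ = 1 := by rw [← sub_eq_zero.1 h0]; simp
    rw [norm_mul, Complex.norm_conj] at h1
    nlinarith [norm_nonneg w, norm_nonneg z]
  have hanalytic : circleAverage (fun z ↦ (z + w) / (z - w) * g z) 0 1 = 2 * g w - g 0 := by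
    have h1 : circleAverage (fun z ↦ ((z - 0) / (z - w)) • g z) 0 1 = g w :=
      DiffContOnCl.circleAverage_smul_div (by simpa using hg) (by simpa using hw)
    have h2 : circleAverage g 0 1 = g 0 := DiffContOnCl.circleAverage (by simpa using hg)
    rw [← h1, ← h2, ← smul_eq_mul, ← circleAverage_fun_smul, ← circleAverage_fun_sub]
    · refine circleAverage_congr_sphere fun z hz ↦ ?_
      have := hzw z (by simpa using hz)
      simp only [smul_eq_mul]
      field_simp
      ring
    · refine ContinuousOn.circleIntegrable zero_le_one ?_
      have hq : ContinuousOn (fun z : ℂ ↦ (z - 0) / (z - w)) (sphere 0 1) :=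
        ContinuousOn.div (by fun_prop) (by fun_prop) hzw
      exact (hq.smul hgc).const_smul (2 : ℂ)
    · exact hgc.circleIntegrable zero_le_one
  have hconj : circleAverage (fun z ↦ (z + w) / (z - w) * conj (g z)) 0 1 = conj (g 0) := by
    have h1 : circleAverage (fun z ↦ (1 + z * conj w) / (1 - z * conj w) * g z) 0 1 = g 0 := by
      have hd : DiffContOnCl ℂ (fun z ↦ (1 + z * conj w) / (1 - z * conj w)) (ball 0 1) := by
        refine DifferentiableOn.diffContOnCl ?_
        rw [closure_ball 0 one_ne_zero]
        exact DifferentiableOn.div (by fun_prop) (by fun_prop) hden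
      have h2 := DiffContOnCl.circleAverage (c := (0 : ℂ)) (R := 1)
        (f := fun z ↦ (1 + z * conj w) / (1 - z * conj w) * g z) (by simpa using hd.smul hg)
      simpa using h2
    rw [← h1, ← Complex.conjCLE_apply, ← ContinuousLinearEquiv.coe_coe,
      ← ContinuousLinearMap.circleAverage_comp_comm]
    · refine circleAverage_congr_sphere fun z hz ↦ ?_
      have hz' : z ∈ sphere (0 : ℂ) 1 := by simpa using hz
      have hzz : z * conj z = 1 := by
        have : ‖z‖ = 1 := by simpa using hz
        rw [Complex.mul_conj, Complex.normSq_eq_norm_sq, this]; simp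
      have h3 := hzw z hz'
      have h4 : 1 - conj z * w ≠ 0 := fun h0 ↦
        hden z (sphere_subset_closedBall hz') (by simpa using congrArg conj h0)
      simp only [Function.comp_apply, ContinuousLinearEquiv.coe_coe, Complex.conjCLE_apply,
        map_mul, map_div₀, map_add, map_sub, map_one, Complex.conj_conj]
      congr 1
      rw [div_eq_div_iff h3 h4]
      linear_combination (-2 * w) * hzz
    · refine ContinuousOn.circleIntegrable zero_le_one (ContinuousOn.mul ?_ hgc)
      exact ContinuousOn.div (by fun_prop) (by fun_prop)
        fun z hz ↦ hden z (sphere_subset_closedBall hz)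
  have hsum : circleAverage (fun z ↦ (z + w) / (z - w) * ((g z).re : ℂ)) 0 1 =
      (1 / 2 : ℂ) * ((2 * g w - g 0) + conj (g 0)) := by
    rw [← hanalytic, ← hconj, ← circleAverage_fun_add, ← smul_eq_mul, ← circleAverage_fun_smul]
    · congr 1
      ext z
      rw [Complex.re_eq_add_conj, smul_eq_mul]
      ring
    · exact (hK.mul hgc).circleIntegrable zero_le_one
    · exact (hK.mul (Complex.continuous_conj.comp_continuousOn hgc)).circleIntegrable zero_le_one
  rw [hsum]
  have him : g 0 - conj (g 0) = 2 * (g 0).im * Complex.I := Complex.sub_conj _ |>.trans (by simp)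
  linear_combination (-1 / 2 : ℂ) * him

/-- A nonnegative continuous density on the unit circle defines a finite measure whose integrals
are weighted circle averages. -/
theorem exists_finiteMeasure_integral_eq_circleAverage {u : ℂ → ℝ}
    (hu : ContinuousOn u (sphere 0 1)) (hu0 : ∀ z ∈ sphere (0 : ℂ) 1, 0 ≤ u z) :
    ∃ μ : FiniteMeasure (sphere (0 : ℂ) 1), ∀ f : ℂ → ℂ, ContinuousOn f (sphere 0 1) →
      ∫ ω : sphere (0 : ℂ) 1, f ω ∂(μ : Measure (sphere (0 : ℂ) 1)) =
        circleAverage (fun z ↦ f z * (u z : ℂ)) 0 1 := by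
  let c : ℝ → sphere (0 : ℂ) 1 := fun θ ↦ ⟨circleMap 0 1 θ, circleMap_mem_sphere 0 zero_le_one θ⟩
  have hc : Continuous c := (continuous_circleMap 0 1).subtype_mk _
  have huc : Continuous fun θ ↦ u (c θ) := hu.comp_continuous (by fun_prop) fun θ ↦ (c θ).2
  let d : ℝ → NNReal := fun θ ↦ ((2 * π)⁻¹ * u (c θ)).toNNReal
  have hd : Continuous d := continuous_real_toNNReal.comp (continuous_const.mul huc)
  let ν : Measure ℝ := (volume.restrict (Set.Ioc 0 (2 * π))).withDensity fun θ ↦ d θ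
  have hν : IsFiniteMeasure ν := by
    refine isFiniteMeasure_withDensity (ne_of_lt ?_)
    have hi : Integrable (fun θ ↦ (d θ : ℝ)) (volume.restrict (Set.Ioc 0 (2 * π))) :=
      (Continuous.integrableOn_Icc (by fun_prop)).mono_set Set.Ioc_subset_Icc_self
    simpa [HasFiniteIntegral] using hi.2
  refine ⟨⟨ν.map c, inferInstance⟩, fun f hf ↦ ?_⟩
  have hfc : Continuous fun ω : sphere (0 : ℂ) 1 ↦ f ω := hf.domRestrict
  rw [FiniteMeasure.toMeasure_mk,
    integral_map hc.measurable.aemeasurable hfc.aestronglyMeasurable,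
    integral_withDensity_eq_integral_smul hd.measurable, circleAverage_def,
    intervalIntegral.integral_of_le two_pi_pos.le, ← integral_smul]
  congr 1
  ext θ
  have h0 : 0 ≤ (2 * π)⁻¹ * u (c θ) := mul_nonneg (by positivity) (hu0 _ (c θ).2)
  rw [NNReal.smul_def, Real.coe_toNNReal _ h0]
  simp only [c, Complex.real_smul]
  push_cast
  ring

/-- Herglotz representation theorem: a function holomorphic on the open unit disk
with nonnegative real part is of the form `h(λ) = i·b + ∫ (ω+λ)/(ω-λ) dμ(ω)` for a
real number `b` and a finite Borel measure `μ` on the unit circle. -/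
theorem herglotz_representation
    (h : ℂ → ℂ)
    (hdiff : ∀ l : ℂ, ‖l‖ < 1 → DifferentiableAt ℂ h l)
    (hre : ∀ l : ℂ, ‖l‖ < 1 → 0 ≤ (h l).re) :
    ∃ (b : ℝ) (μ : Measure (Metric.sphere (0 : ℂ) 1)), IsFiniteMeasure μ ∧
      ∀ l : ℂ, ‖l‖ < 1 →
        h l = Complex.I * (b : ℂ) +
          ∫ ω : Metric.sphere (0 : ℂ) 1, ((ω : ℂ) + l) / ((ω : ℂ) - l) ∂μ := by
  have hmaps : ∀ r ∈ Set.Ioo (0 : ℝ) 1, ∀ z : ℂ, ‖z‖ ≤ 1 → ‖(r : ℂ) * z‖ < 1 := by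
    intro r hr z hz
    rw [norm_mul, Complex.norm_real, norm_of_nonneg hr.1.le]
    nlinarith [hr.1, hr.2, norm_nonneg z]
  have hdil : ∀ r ∈ Set.Ioo (0 : ℝ) 1, ∃ μ : FiniteMeasure (sphere (0 : ℂ) 1),
      ∀ l : ℂ, ‖l‖ < 1 → ∫ ω : sphere (0 : ℂ) 1, ((ω : ℂ) + l) / ((ω : ℂ) - l)
        ∂(μ : Measure (sphere (0 : ℂ) 1)) = h (r * l) - Complex.I * ((h 0).im : ℂ) := by
    intro r hr
    have hd : DifferentiableOn ℂ (fun z ↦ h (r * z)) (closedBall 0 1) := fun z hz ↦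
      (DifferentiableAt.comp z (hdiff _ (hmaps r hr z (by simpa using hz)))
        (by fun_prop)).differentiableWithinAt
    obtain ⟨μ, hμ⟩ := exists_finiteMeasure_integral_eq_circleAverage
      (u := fun z ↦ (h (r * z)).re)
      (Complex.continuous_re.comp_continuousOn (hd.continuousOn.mono sphere_subset_closedBall))
      fun z hz ↦ hre _ (hmaps r hr z (by simpa using (mem_sphere.1 hz).le))
    refine ⟨μ, fun l hl ↦ ?_⟩
    have hs := schwarz_integral_formula (g := fun z ↦ h (r * z)) (w := l)
      (DifferentiableOn.diffContOnCl (by rwa [closure_ball 0 one_ne_zero])) (by simpa using hl)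
    rw [hμ (fun z ↦ (z + l) / (z - l)), hs, mul_zero]
    exact ContinuousOn.div (by fun_prop) (by fun_prop) fun z hz h0 ↦ by
      have : ‖z‖ = 1 := by simpa using hz
      rw [sub_eq_zero.1 h0] at this
      exact hl.ne this
  obtain ⟨r, -, hr, hrlim⟩ := exists_seq_strictMono_tendsto' (zero_lt_one (α := ℝ))
  choose μ hμ using fun n ↦ hdil (r n) (hr n)
  have hmass : ∀ n, (μ n).mass ≤ (h 0).re.toNNReal := by
    intro n
    have h1 : ∫ ω : sphere (0 : ℂ) 1, (1 : ℂ) ∂(μ n : Measure (sphere (0 : ℂ) 1)) =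
        h 0 - Complex.I * ((h 0).im : ℂ) := by
      have h0 := hμ n 0 (by simp)
      rw [mul_zero] at h0
      rw [← h0]
      refine integral_congr_ae (.of_forall fun ω ↦ ?_)
      have : (ω : ℂ) ≠ 0 := ne_zero_of_mem_unit_sphere ω
      simp [this]
    have h2 := congrArg Complex.re h1
    rw [integral_const] at h2
    rw [Real.le_toNNReal_iff_coe_le (hre 0 (by simp))]
    refine le_of_eq ?_
    simpa using h2
  have hcompact := isCompact_setOfPred_finiteMeasure_le_of_compactSpace
    (sphere (0 : ℂ) 1) (h 0).re.toNNReal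
  obtain ⟨ν, -, hν⟩ := isCompact_iff_ultrafilter_le_nhds'.1 hcompact ((hyperfilter ℕ).map μ)
    (Ultrafilter.mem_map.2 (univ_mem' hmass))
  have hνlim : Tendsto μ (hyperfilter ℕ) (𝓝 ν) := hν
  refine ⟨(h 0).im, ν, inferInstance, fun l hl ↦ ?_⟩
  have hK : Continuous fun ω : sphere (0 : ℂ) 1 ↦ ((ω : ℂ) + l) / ((ω : ℂ) - l) :=
    Continuous.div (by fun_prop) (by fun_prop) fun ω h0 ↦ by
      have : ‖(ω : ℂ)‖ = 1 := norm_eq_of_mem_sphere ω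
      rw [sub_eq_zero.1 h0] at this
      exact hl.ne this
  have hlim₁ := (FiniteMeasure.tendsto_iff_forall_integral_rclike_tendsto ℂ).1 hνlim
    (BoundedContinuousFunction.mkOfCompact ⟨_, hK⟩)
  have hlim₂ : Tendsto (fun n ↦ h (r n * l) - Complex.I * ((h 0).im : ℂ)) (hyperfilter ℕ)
      (𝓝 (h l - Complex.I * ((h 0).im : ℂ))) := by
    refine Tendsto.sub_const ?_ _
    refine (hdiff l hl).continuousAt.tendsto.comp ?_
    have : Tendsto (fun n ↦ (r n : ℂ) * l) atTop (𝓝 (((1 : ℝ) : ℂ) * l)) :=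
      ((Complex.continuous_ofReal.tendsto 1).comp hrlim).mul_const l
    simpa using this.mono_left Nat.hyperfilter_le_atTop
  have heq := tendsto_nhds_unique hlim₁ (hlim₂.congr fun n ↦ (hμ n l hl).symm)
  simp only [BoundedContinuousFunction.mkOfCompact_apply, ContinuousMap.coe_mk] at heq
  rw [heq]
  ring
end

section
/- (Homomorphic Tomiyama's theorem.) Let M and B be unital C*-algebras, let B̂ be a unital *-subalgebra of M, and let E : M → B be a unital completely positive linear map whose restriction to B̂ is a *-homomorphism (i.e., E(xy) = E(x)E(y) and E(x*) = E(x)* for all x, y ∈ B̂). Then for all b₁, b₂ ∈ B̂ and all m ∈ M, E(b₁ m b₂) = E(b₁) E(m) E(b₂). -/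
open Finset

/-- In a C*-algebra, a finite sum of elements `star (w i) * w i` vanishes only if every `w i` does. -/
theorem CStarRing.eq_zero_of_sum_star_mul_self_eq_zero {A ι : Type*} [Fintype ι]
    [NormedRing A] [StarRing A] [CStarRing A] [CompleteSpace A]
    [NormedAlgebra ℂ A] [StarModule ℂ A] {w : ι → A}
    (h : ∑ i, star (w i) * w i = 0) (i : ι) : w i = 0 := by
  let : CStarAlgebra A := {}
  let := CStarAlgebra.spectralOrder A
  have := CStarAlgebra.spectralOrderedRing A
  rw [sum_eq_zero_iff_of_nonneg fun i _ ↦ star_mul_self_nonneg (w i)] at h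
  exact CStarRing.star_mul_self_eq_zero_iff _ |>.mp (h i (mem_univ i))

/-- If `E` sends squares `star y * y` of `n × n` matrices to squares, then for every family `a` the
matrix `E (star (a i) * a j)` is the Gram matrix of the columns of some matrix `z`. -/
theorem exists_gram_of_map_star_mul_self {M B : Type*} [Ring M] [StarRing M] [Ring B] [StarRing B]
    {n : ℕ} [NeZero n] (E : M → B)
    (hE : ∀ x : Matrix (Fin n) (Fin n) M, (∃ y : Matrix (Fin n) (Fin n) M, x = star y * y) →
      ∃ z : Matrix (Fin n) (Fin n) B, x.map E = star z * z)
    (a : Fin n → M) :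
    ∃ z : Matrix (Fin n) (Fin n) B, ∀ i j, E (star (a i) * a j) = ∑ k, star (z k i) * z k j := by
  let y : Matrix (Fin n) (Fin n) M := Matrix.of fun k j ↦ if k = 0 then a j else 0
  obtain ⟨z, hz⟩ := hE _ ⟨y, rfl⟩
  refine ⟨z, fun i j ↦ ?_⟩
  have hij := congrFun₂ hz i j
  simpa [Matrix.mul_apply, Matrix.star_apply, y, apply_ite star, ite_mul] using hij

/-- Left and right multiplicativity of a unital 3-positive map at an element `x` with
`E (star x * x) = star (E x) * E x`. -/
theorem map_star_mul_of_map_star_mul_self {M B : Type*} [Ring M] [StarRing M]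
    [NormedRing B] [StarRing B] [CStarRing B] [CompleteSpace B]
    [NormedAlgebra ℂ B] [StarModule ℂ B] (E : M → B) (hunital : E 1 = 1)
    (hE : ∀ x : Matrix (Fin 3) (Fin 3) M, (∃ y : Matrix (Fin 3) (Fin 3) M, x = star y * y) →
      ∃ z : Matrix (Fin 3) (Fin 3) B, x.map E = star z * z)
    {x : M} (hx : E (star x * x) = star (E x) * E x) (m : M) :
    E (star x * m) = star (E x) * E m ∧ E (star m * x) = E (star m) * E x := by
  obtain ⟨z, hz⟩ := exists_gram_of_map_star_mul_self E hE ![1, x, m]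
  have h00 := hz 0 0
  have h01 := hz 0 1
  have h11 := hz 1 1
  have h02 := hz 0 2
  have h20 := hz 2 0
  have h12 := hz 1 2
  have h21 := hz 2 1
  simp only [Matrix.cons_val, star_one, one_mul, mul_one, hunital]
    at h00 h01 h11 h02 h20 h12 h21
  have h10 : ∑ k, star (z k 1) * z k 0 = star (E x) := by
    simp [h01, star_sum]
  have hw : ∀ k, z k 1 - z k 0 * E x = 0 := by
    refine CStarRing.eq_zero_of_sum_star_mul_self_eq_zero ?_
    have hexp : ∀ k, star (z k 1 - z k 0 * E x) * (z k 1 - z k 0 * E x) =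
        star (z k 1) * z k 1 - star (z k 1) * z k 0 * E x - star (E x) * (star (z k 0) * z k 1)
          + star (E x) * (star (z k 0) * z k 0) * E x := fun k ↦ by
      simp only [star_sub, star_mul]
      noncomm_ring
    simp only [hexp, sum_add_distrib, sum_sub_distrib, ← sum_mul, ← mul_sum, ← h00, ← h01, ← h11,
      h10, hx]
    noncomm_ring
  have hz1 : ∀ k, z k 1 = z k 0 * E x := fun k ↦ sub_eq_zero.mp (hw k)
  constructor
  · rw [h12, h02, mul_sum]
    exact sum_congr rfl fun k _ ↦ by rw [hz1 k, star_mul, mul_assoc]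
  · rw [h21, h20, sum_mul]
    exact sum_congr rfl fun k _ ↦ by rw [hz1 k, mul_assoc]

/-- Homomorphic Tomiyama's theorem: if `E : M → B` is a unital completely positive
linear map between unital C*-algebras whose restriction to a unital *-subalgebra
`B̂ ⊆ M` is a *-homomorphism, then `E(b₁ m b₂) = E(b₁) E(m) E(b₂)` for all
`b₁, b₂ ∈ B̂` and `m ∈ M`.  Complete positivity is expressed via the
characterization of positive elements of a C*-algebra (here, of the matrix
C*-algebras over `M` and `B`) as those of the form `star y * y`. -/
theorem homomorphic_tomiyama
    {M B : Type*}
    [NormedRing M] [StarRing M] [CStarRing M] [CompleteSpace M]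
    [NormedAlgebra ℂ M] [StarModule ℂ M]
    [NormedRing B] [StarRing B] [CStarRing B] [CompleteSpace B]
    [NormedAlgebra ℂ B] [StarModule ℂ B]
    (E : M →ₗ[ℂ] B)
    (hunital : E 1 = 1)
    (hcp : ∀ (n : ℕ) (x : Matrix (Fin n) (Fin n) M),
      (∃ y : Matrix (Fin n) (Fin n) M, x = star y * y) →
      ∃ z : Matrix (Fin n) (Fin n) B, x.map E = star z * z)
    (S : StarSubalgebra ℂ M)
    (hmul : ∀ x ∈ S, ∀ y ∈ S, E (x * y) = E x * E y)
    (hstar : ∀ x ∈ S, E (star x) = star (E x)) :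
    ∀ b₁ ∈ S, ∀ b₂ ∈ S, ∀ m : M, E (b₁ * m * b₂) = E b₁ * E m * E b₂ := by
  intro b₁ hb₁ b₂ hb₂ m
  have hsq : ∀ x ∈ S, E (star x * x) = star (E x) * E x := fun x hx ↦ by
    rw [hmul _ (star_mem hx) _ hx, hstar x hx]
  have hright : E (b₁ * m * b₂) = E (b₁ * m) * E b₂ := by
    simpa only [star_star] using
      (map_star_mul_of_map_star_mul_self E hunital (hcp 3) (hsq b₂ hb₂) (star (b₁ * m))).2
  have hleft : E (b₁ * m) = E b₁ * E m := by
    simpa only [hstar b₁ hb₁, star_star] using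
      (map_star_mul_of_map_star_mul_self E hunital (hcp 3) (hsq _ (star_mem hb₁)) m).1
  rw [hright, hleft]
end

section
/- Let M and B be unital C*-algebras and let E : M → B be a unital completely positive linear map. Let e ∈ M be a projection (e = e* = e²) such that E(e) is a projection in B. Then for every m ∈ M, E(e·m) = E(e)·E(m) and E(m·e) = E(m)·E(e). -/
/-- In a C⋆-algebra, a finite sum of elements `star (w i) * w i` vanishes only if every `w i`
does. -/
theorem eq_zero_of_sum_star_mul_self_eq_zero {B ι : Type*} [CStarAlgebra B] [Fintype ι]
    {w : ι → B} (h : ∑ i, star (w i) * w i = 0) (i : ι) : w i = 0 := by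
  let _ := CStarAlgebra.spectralOrder B
  have := CStarAlgebra.spectralOrderedRing B
  have hi := (Finset.sum_eq_zero_iff_of_nonneg fun j _ => star_mul_self_nonneg (w j)).1 h i
    (Finset.mem_univ i)
  exact (CStarRing.star_mul_self_eq_zero_iff _).1 hi

/-- A completely positive linear map sends the Gram matrix `(star (a i) * a j)` of a tuple `a` to
the Gram matrix of the columns of some matrix. -/
theorem exists_gram_of_completelyPositive {M B : Type*} [Ring M] [StarRing M] [Ring B] [StarRing B]
    (E : M → B) {n : ℕ}
    (hE : ∀ x : Matrix (Fin (n + 1)) (Fin (n + 1)) M,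
      (∃ y : Matrix (Fin (n + 1)) (Fin (n + 1)) M, x = star y * y) →
      ∃ z : Matrix (Fin (n + 1)) (Fin (n + 1)) B, x.map E = star z * z)
    (a : Fin (n + 1) → M) :
    ∃ z : Matrix (Fin (n + 1)) (Fin (n + 1)) B,
      ∀ i j, E (star (a i) * a j) = ∑ k, star (z k i) * z k j := by
  obtain ⟨z, hz⟩ := hE _ ⟨Matrix.of fun i j => if i = 0 then a j else 0, rfl⟩
  refine ⟨z, fun i j => ?_⟩
  have hij := congrFun (congrFun hz i) j
  simpa [Matrix.mul_apply, Matrix.star_apply, apply_ite star, ite_mul] using hij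

/-- If `E : M → B` is a unital completely positive linear map between unital
C*-algebras and `e ∈ M` is a projection such that `E(e)` is a projection in `B`,
then `E(e·m) = E(e)·E(m)` and `E(m·e) = E(m)·E(e)` for every `m ∈ M`.  Complete
positivity is expressed via the characterization of positive elements of a
C*-algebra (here, of the matrix C*-algebras over `M` and `B`) as those of the
form `star y * y`. -/
theorem ucp_projection_multiplicative
    {M B : Type*}
    [NormedRing M] [StarRing M] [CStarRing M] [CompleteSpace M]
    [NormedAlgebra ℂ M] [StarModule ℂ M]
    [NormedRing B] [StarRing B] [CStarRing B] [CompleteSpace B]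
    [NormedAlgebra ℂ B] [StarModule ℂ B]
    (E : M →ₗ[ℂ] B)
    (hunital : E 1 = 1)
    (hcp : ∀ (n : ℕ) (x : Matrix (Fin n) (Fin n) M),
      (∃ y : Matrix (Fin n) (Fin n) M, x = star y * y) →
      ∃ z : Matrix (Fin n) (Fin n) B, x.map E = star z * z)
    (e : M) (he_star : star e = e) (he_idem : e * e = e)
    (hEe_star : star (E e) = E e) (hEe_idem : E e * E e = E e) :
    ∀ m : M, E (e * m) = E e * E m ∧ E (m * e) = E m * E e := by
  let : CStarAlgebra B := {}
  -- Writing `z i` for the columns of a Gram factorization of `E` on `(1, e, m)`, the vector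
  -- `z 1 - z 0 * E e` has zero norm.
  have key (m : M) : E (e * m) = E e * E m ∧ E (star m * e) = E (star m) * E e := by
    obtain ⟨z, hz⟩ := exists_gram_of_completelyPositive E (hcp 3) ![1, e, m]
    have h00 := hz 0 0
    have h01 := hz 0 1
    have h10 := hz 1 0
    have h11 := hz 1 1
    have h02 := hz 0 2
    have h20 := hz 2 0
    have h12 := hz 1 2
    have h21 := hz 2 1
    simp only [Matrix.cons_val, star_one, one_mul, mul_one, he_star, he_idem, hunital]
      at h00 h01 h10 h11 h02 h20 h12 h21
    have hw : ∑ k, star (z k 1 - z k 0 * E e) * (z k 1 - z k 0 * E e) = 0 := by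
      have expand : ∀ k, star (z k 1 - z k 0 * E e) * (z k 1 - z k 0 * E e) =
          star (z k 1) * z k 1 - star (z k 1) * z k 0 * E e - E e * (star (z k 0) * z k 1)
            + E e * (star (z k 0) * z k 0) * E e := by
        intro k
        rw [star_sub, star_mul, hEe_star]
        noncomm_ring
      simp only [expand, Finset.sum_add_distrib, Finset.sum_sub_distrib, ← Finset.mul_sum,
        ← Finset.sum_mul, ← h00, ← h01, ← h10, ← h11, mul_one, hEe_idem]
      abel
    have hz1 (k : Fin 3) : z k 1 = z k 0 * E e :=
      sub_eq_zero.1 (eq_zero_of_sum_star_mul_self_eq_zero hw k)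
    constructor
    · rw [h12, h02, Finset.mul_sum]
      simp only [hz1, star_mul, hEe_star, mul_assoc]
    · rw [h21, h20, Finset.sum_mul]
      simp only [hz1, mul_assoc]
  exact fun m => ⟨(key m).1, by simpa using (key (star m)).2⟩
end

section
/- Let z₁, z₂ ∈ ℂ with Im z₁ > 0 and Im z₂ > 0. Let A be the 3×3 complex matrix with A_{1,2} = A_{2,1} = 1 (0-indexed: entries (1,2) and (2,1) equal 1) and all other entries 0, and let D be the diagonal 3×3 matrix with diagonal entries z₁, z₂, (z₁ + z₂)/2. Then A - D is invertible, the (0,0) entry of (A - D)⁻¹ equals -z₁⁻¹, and the (1,1) entry of (A - D)⁻¹ equals -(z₁ + z₂)/(z₂(z₁ + z₂) - 2). -/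
/-- The product of two points of the open upper half plane is never a nonnegative real. -/
lemma Complex.mul_ne_ofReal_of_im_pos {z w : ℂ} (hz : 0 < z.im) (hw : 0 < w.im)
    {r : ℝ} (hr : 0 ≤ r) : z * w ≠ r := by
  intro h
  have hre : z.re * w.re - z.im * w.im = r := by simpa using congrArg Complex.re h
  have him : z.re * w.im + z.im * w.re = 0 := by simpa using congrArg Complex.im h
  have key : w.im * r = -(z.im * (w.re ^ 2 + w.im ^ 2)) := by
    linear_combination (-w.im) * hre + w.re * him
  have : 0 < z.im * (w.re ^ 2 + w.im ^ 2) := by positivity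
  have : 0 ≤ w.im * r := by positivity
  linarith

/-- The computation underlying the counterexample: with `A` the 3×3 matrix swapping
the second and third coordinates (entries `(1,2)` and `(2,1)` equal to 1, all
others 0) and `D = diag(z₁, z₂, (z₁+z₂)/2)` for `z₁, z₂` in the open upper half
plane, `A - D` is invertible, the `(0,0)` entry of `(A - D)⁻¹` is `-z₁⁻¹`, and the
`(1,1)` entry of `(A - D)⁻¹` is `-(z₁+z₂)/(z₂(z₁+z₂) - 2)`. -/
theorem counterexample_resolvent_entries
    (z₁ z₂ : ℂ) (h₁ : 0 < z₁.im) (h₂ : 0 < z₂.im)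
    (A D : Matrix (Fin 3) (Fin 3) ℂ)
    (hA : A = !![0, 0, 0; 0, 0, 1; 0, 1, 0])
    (hD : D = Matrix.diagonal ![z₁, z₂, (z₁ + z₂) / 2]) :
    IsUnit (A - D) ∧ (A - D)⁻¹ 0 0 = -z₁⁻¹ ∧
      (A - D)⁻¹ 1 1 = -(z₁ + z₂) / (z₂ * (z₁ + z₂) - 2) := by
  have hz₁ : z₁ ≠ 0 := by
    rintro rfl
    simp at h₁
  have hq : z₂ * (z₁ + z₂) - 2 ≠ 0 := by
    have hs : 0 < (z₁ + z₂).im := by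
      rw [Complex.add_im]
      positivity
    simpa [sub_ne_zero] using Complex.mul_ne_ofReal_of_im_pos h₂ hs zero_le_two
  have hmul : (A - D) *
      !![-z₁⁻¹, 0, 0;
        0, -(z₁ + z₂) / (z₂ * (z₁ + z₂) - 2), -2 / (z₂ * (z₁ + z₂) - 2);
        0, -2 / (z₂ * (z₁ + z₂) - 2), -2 * z₂ / (z₂ * (z₁ + z₂) - 2)] = 1 := by
    subst hA hD
    ext i j
    fin_cases i <;> fin_cases j <;>
      simp [Matrix.mul_apply, Fin.sum_univ_three, hz₁] <;> field_simp <;> ring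
  refine ⟨IsUnit.of_mul_eq_one _ hmul, ?_, ?_⟩ <;> simp [Matrix.inv_eq_right_inv hmul]
end
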